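/- For the Softmax-attention Transformer loss on a single sample X_i, the gradient with respect to the collected query weights satisfies ‖∇_{W^Q} f(M; X_i)‖_F ≤ Q_i ‖MH(M; X_i) − y_i‖₂, where Q_i = n √H ‖X_i‖_F³ ‖W^O‖₂ √(Σ_{h=1}^H σ_max²(W^K_h)) · σ_max(W^V). -/

import Mathlib

open scoped BigOperators
open scoped Matrix

noncomputable section

namespace Paper

/-- Euclidean (`ℓ²`) norm of a finite family of reals. -/
def enorm {ι : Type*} [Fintype ι] (v : ι → ℝ) : ℝ := Real.sqrt (∑ i, v i ^ 2)

/-- Frobenius norm of a real matrix. -/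
def frob {m k : Type*} [Fintype m] [Fintype k] (A : Matrix m k ℝ) : ℝ :=
  Real.sqrt (∑ i, ∑ j, A i j ^ 2)

/-- Largest singular value of a real matrix: `sup` of `‖A v‖₂` over unit vectors `v`. -/
def sigmaMax {m k : Type*} [Fintype m] [Fintype k] (A : Matrix m k ℝ) : ℝ :=
  sSup {c | ∃ v : k → ℝ, (∑ j, v j ^ 2) = 1 ∧ c = enorm (A.mulVec v)}

/-- Smallest singular value of a (full row rank) real matrix:
`inf` of `‖uᵀ A‖₂` over unit vectors `u`. -/
def sigmaMin {m k : Type*} [Fintype m] [Fintype k] (A : Matrix m k ℝ) : ℝ :=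
  sInf {c | ∃ u : m → ℝ, (∑ i, u i ^ 2) = 1 ∧ c = enorm (Matrix.vecMul u A)}

variable {N n D d H : ℕ}

/-- Attention logits `C = X W^Q (X W^K)ᵀ / √d`. -/
def attnC (WQ WK : Matrix (Fin D) (Fin d) ℝ) (Xi : Matrix (Fin n) (Fin D) ℝ) :
    Matrix (Fin n) (Fin n) ℝ :=
  (Real.sqrt (d : ℝ))⁻¹ • (Xi * WQ * (Xi * WK)ᵀ)

/-- Row-wise softmax of a square matrix. -/
def softmaxMat (Z : Matrix (Fin n) (Fin n) ℝ) : Matrix (Fin n) (Fin n) ℝ :=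
  Matrix.of fun k j => Real.exp (Z k j) / ∑ l, Real.exp (Z k l)

/-- Softmax attention kernel. -/
def Ssoft (WQ WK : Matrix (Fin D) (Fin d) ℝ) (Xi : Matrix (Fin n) (Fin D) ℝ) :
    Matrix (Fin n) (Fin n) ℝ :=
  softmaxMat (attnC WQ WK Xi)

/-- Gaussian attention kernel. -/
def Sgauss (WQ WK : Matrix (Fin D) (Fin d) ℝ) (Xi : Matrix (Fin n) (Fin D) ℝ) :
    Matrix (Fin n) (Fin n) ℝ :=
  Matrix.of fun k j =>
    Real.exp (-(∑ l, (Matrix.vecMul (Xi k) WQ l - Matrix.vecMul (Xi j) WK l) ^ 2) /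
      (2 * Real.sqrt (d : ℝ)))

/-- Multi-head attention output on one sample, for given head kernels `S h`. -/
def MH (S : Fin H → Matrix (Fin n) (Fin n) ℝ) (WV : Fin H → Matrix (Fin D) (Fin d) ℝ)
    (WO : Fin H → Fin d → ℝ) (Xi : Matrix (Fin n) (Fin D) ℝ) : Fin n → ℝ :=
  fun k => ∑ h, ∑ l, (S h * Xi * WV h) k l * WO h l

/-- Squared-error loss `½ Σᵢ ‖out i − y i‖²`. -/
def lossOf (out y : Fin N → Fin n → ℝ) : ℝ :=
  (1 / 2) * ∑ i, ∑ k, (out i k - y i k) ^ 2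

/-- The stacked matrix `B ∈ ℝ^{Nn × HD}` whose `(i,h)` block is `S_{ih} X_i`. -/
def Bmat (S : Fin N → Fin H → Matrix (Fin n) (Fin n) ℝ)
    (X : Fin N → Matrix (Fin n) (Fin D) ℝ) :
    Matrix (Fin N × Fin n) (Fin H × Fin D) ℝ :=
  Matrix.of fun ik hp => (S ik.1 hp.1 * X ik.1) ik.2 hp.2

/-- Block-diagonal stacked value matrix `W^V = diag(W^V_1, …, W^V_H)`. -/
def diagWV (WV : Fin H → Matrix (Fin D) (Fin d) ℝ) :
    Matrix (Fin H × Fin D) (Fin H × Fin d) ℝ :=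
  Matrix.of fun hp hq => if hp.1 = hq.1 then WV hp.1 hp.2 hq.2 else 0

/-- Euclidean norm of the output weight `W^O ∈ ℝ^{Hd×1}`. -/
def WOnorm (WO : Fin H → Fin d → ℝ) : ℝ := enorm fun hl : Fin H × Fin d => WO hl.1 hl.2

/-- Frobenius norm of the row-stacked data matrix `X ∈ ℝ^{Nn×D}`. -/
def XF (X : Fin N → Matrix (Fin n) (Fin D) ℝ) : ℝ :=
  Real.sqrt (∑ i, ∑ k, ∑ p, X i k p ^ 2)

/-- The `h`-th head matrix of a packed head-indexed parameter vector. -/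
def headMat (v : EuclideanSpace ℝ (Fin H × Fin D × Fin d)) (h : Fin H) :
    Matrix (Fin D) (Fin d) ℝ :=
  Matrix.of fun p q => v (h, p, q)

/-- Index type for the full parameter set `M = (W^Q, W^K, W^V)`. -/
abbrev FullIdx (H D d : ℕ) := Fin 3 × Fin H × Fin D × Fin d

/-- Query weights of the packed full parameter vector. -/
def mQ (v : EuclideanSpace ℝ (FullIdx H D d)) (h : Fin H) : Matrix (Fin D) (Fin d) ℝ :=
  Matrix.of fun p q => v (0, h, p, q)

/-- Key weights of the packed full parameter vector. -/
def mK (v : EuclideanSpace ℝ (FullIdx H D d)) (h : Fin H) : Matrix (Fin D) (Fin d) ℝ :=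
  Matrix.of fun p q => v (1, h, p, q)

/-- Value weights of the packed full parameter vector. -/
def mV (v : EuclideanSpace ℝ (FullIdx H D d)) (h : Fin H) : Matrix (Fin D) (Fin d) ℝ :=
  Matrix.of fun p q => v (2, h, p, q)

/-- A packed `D × d` parameter vector as a matrix. -/
def toMat2 {D d : ℕ} (w : EuclideanSpace ℝ (Fin D × Fin d)) : Matrix (Fin D) (Fin d) ℝ :=
  Matrix.of fun p q => w (p, q)

lemma enorm_nonneg' {ι : Type*} [Fintype ι] (v : ι → ℝ) : 0 ≤ enorm v := Real.sqrt_nonneg _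

lemma frob_nonneg' {m k : Type*} [Fintype m] [Fintype k] (A : Matrix m k ℝ) : 0 ≤ frob A :=
  Real.sqrt_nonneg _

lemma enorm_sq' {ι : Type*} [Fintype ι] (v : ι → ℝ) : enorm v ^ 2 = ∑ i, v i ^ 2 :=
  Real.sq_sqrt (Finset.sum_nonneg fun _ _ => sq_nonneg _)

lemma frob_sq' {m k : Type*} [Fintype m] [Fintype k] (A : Matrix m k ℝ) :
    frob A ^ 2 = ∑ i, ∑ j, A i j ^ 2 :=
  Real.sq_sqrt (Finset.sum_nonneg fun _ _ => Finset.sum_nonneg fun _ _ => sq_nonneg _)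

lemma abs_sum_le_enorm {ι : Type*} [Fintype ι] (a b : ι → ℝ) :
    |∑ i, a i * b i| ≤ enorm a * enorm b := by
  refine abs_le_of_sq_le_sq ?_ (mul_nonneg (enorm_nonneg' a) (enorm_nonneg' b))
  rw [mul_pow, enorm_sq', enorm_sq']
  exact Finset.sum_mul_sq_le_sq_mul_sq _ _ _

lemma enorm_le_of_sq {ι : Type*} [Fintype ι] (a : ι → ℝ) (K : ℝ) (hK : 0 ≤ K)
    (h : ∑ i, a i ^ 2 ≤ K ^ 2) : enorm a ≤ K := by
  apply le_of_sq_le_sq _ hK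
  rwa [enorm_sq']

lemma enorm_mulVec_le_frob {m k : Type*} [Fintype m] [Fintype k] (A : Matrix m k ℝ)
    (v : k → ℝ) : enorm (A.mulVec v) ≤ frob A * enorm v := by
  apply enorm_le_of_sq _ _ (mul_nonneg (frob_nonneg' A) (enorm_nonneg' v))
  rw [mul_pow, frob_sq', enorm_sq', Finset.sum_mul]
  apply Finset.sum_le_sum
  intro i _
  exact Finset.sum_mul_sq_le_sq_mul_sq _ _ _

lemma sigmaMax_nonneg' {m k : Type*} [Fintype m] [Fintype k] (A : Matrix m k ℝ) :
    0 ≤ sigmaMax A := by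
  apply Real.sSup_nonneg
  rintro c ⟨v, _, rfl⟩
  exact enorm_nonneg' _

lemma enorm_smul' {ι : Type*} [Fintype ι] (t : ℝ) (ht : 0 ≤ t) (v : ι → ℝ) :
    enorm (t • v) = t * enorm v := by
  unfold enorm
  simp only [Pi.smul_apply, smul_eq_mul, mul_pow, ← Finset.mul_sum]
  rw [Real.sqrt_mul (sq_nonneg t), Real.sqrt_sq ht]

lemma enorm_mulVec_le_sigmaMax {m k : Type*} [Fintype m] [Fintype k] (A : Matrix m k ℝ)
    (v : k → ℝ) : enorm (A.mulVec v) ≤ sigmaMax A * enorm v := by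
  by_cases h0 : enorm v = 0
  · have := enorm_mulVec_le_frob A v
    rw [h0] at this ⊢
    simpa using this
  · have hpos : 0 < enorm v := lt_of_le_of_ne (enorm_nonneg' v) (Ne.symm h0)
    have hb : BddAbove {c | ∃ v : k → ℝ, (∑ j, v j ^ 2) = 1 ∧ c = enorm (A.mulVec v)} := by
      refine ⟨frob A, ?_⟩
      rintro c ⟨w, hw, rfl⟩
      have := enorm_mulVec_le_frob A w
      have h1 : enorm w = 1 := by unfold enorm; rw [hw]; simp
      simpa [h1] using this
    have hmem : enorm (A.mulVec ((enorm v)⁻¹ • v)) ≤ sigmaMax A := by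
      apply le_csSup hb
      refine ⟨_, ?_, rfl⟩
      rw [← enorm_sq', enorm_smul' _ (inv_nonneg.mpr hpos.le), inv_mul_cancel₀ h0]
      norm_num
    rw [Matrix.mulVec_smul, enorm_smul' _ (inv_nonneg.mpr hpos.le)] at hmem
    rwa [inv_mul_le_iff₀ hpos, mul_comm] at hmem

lemma enorm_WV_WO (WV : Fin H → Matrix (Fin D) (Fin d) ℝ) (WO : Fin H → Fin d → ℝ) (h : Fin H) :
    enorm ((WV h).mulVec (WO h)) ≤ sigmaMax (diagWV WV) * WOnorm WO := by
  refine le_trans ?_ (enorm_mulVec_le_sigmaMax (diagWV WV) fun hl : Fin H × Fin d => WO hl.1 hl.2)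
  apply enorm_le_of_sq _ _ (enorm_nonneg' _)
  rw [enorm_sq', Fintype.sum_prod_type]
  have key : ∀ h' p, (diagWV WV).mulVec (fun hl : Fin H × Fin d => WO hl.1 hl.2) (h', p)
      = (WV h').mulVec (WO h') p := by
    intro h' p
    simp [Matrix.mulVec, dotProduct, diagWV, Fintype.sum_prod_type]
  simp only [key]
  exact Finset.single_le_sum (f := fun h' => ∑ p, (WV h').mulVec (WO h') p ^ 2)
    (fun _ _ => Finset.sum_nonneg fun _ _ => sq_nonneg _) (Finset.mem_univ h)

lemma var_bound {ι : Type*} [Fintype ι] (p u : ι → ℝ) (hp : ∀ j, 0 ≤ p j) (h1 : ∑ j, p j = 1) :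
    ∑ j, p j * (u j - ∑ l, p l * u l) ^ 2 ≤ enorm u ^ 2 := by
  set m := ∑ l, p l * u l with hm
  have e : ∑ j, p j * (u j - m) ^ 2 = ∑ j, p j * u j ^ 2 - m ^ 2 := by
    have : ∀ j, p j * (u j - m) ^ 2 = p j * u j ^ 2 - 2 * m * (p j * u j) + m ^ 2 * p j := by
      intro j; ring
    simp only [this, Finset.sum_add_distrib, Finset.sum_sub_distrib, ← Finset.mul_sum, h1, ← hm]
    ring
  rw [e, enorm_sq']
  have : ∑ j, p j * u j ^ 2 ≤ ∑ j, u j ^ 2 := by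
    apply Finset.sum_le_sum
    intro j _
    have : p j ≤ 1 := by
      rw [← h1]; exact Finset.single_le_sum (fun i _ => hp i) (Finset.mem_univ j)
    nlinarith [sq_nonneg (u j)]
  nlinarith [sq_nonneg m]

lemma cov_bound {ι : Type*} [Fintype ι] (p u c : ι → ℝ) (hp : ∀ j, 0 ≤ p j)
    (h1 : ∑ j, p j = 1) :
    |∑ j, p j * c j * u j - (∑ j, p j * u j) * ∑ j, p j * c j| ≤ enorm u * enorm c := by
  set mu := ∑ l, p l * u l with hmu
  set mc := ∑ l, p l * c l with hmc
  have e : ∑ j, p j * c j * u j - mu * mc =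
      ∑ j, (√(p j) * (u j - mu)) * (√(p j) * (c j - mc)) := by
    have : ∀ j, (√(p j) * (u j - mu)) * (√(p j) * (c j - mc)) =
        p j * c j * u j - mc * (p j * u j) - mu * (p j * c j) + mu * mc * p j := by
      intro j
      have := Real.mul_self_sqrt (hp j)
      linear_combination (u j - mu) * (c j - mc) * this
    simp only [this, Finset.sum_add_distrib, Finset.sum_sub_distrib, ← Finset.mul_sum, h1,
      ← hmu, ← hmc]
    ring
  rw [e]
  refine (abs_sum_le_enorm _ _).trans ?_
  have b : ∀ w : ι → ℝ, enorm (fun j => √(p j) * (w j - ∑ l, p l * w l)) ≤ enorm w := by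
    intro w
    apply enorm_le_of_sq _ _ (enorm_nonneg' w)
    refine le_trans (le_of_eq ?_) (var_bound p w hp h1)
    apply Finset.sum_congr rfl
    intro j _
    rw [mul_pow, Real.sq_sqrt (hp j)]
  exact mul_le_mul (b u) (b c) (enorm_nonneg' _) (enorm_nonneg' _)

lemma softmax_line {ι : Type*} [Fintype ι] [Nonempty ι] (a c u : ι → ℝ) :
    ∃ g' : ℝ, HasDerivAt (fun t : ℝ => ∑ j, Real.exp (a j + t * c j) /
      (∑ l, Real.exp (a l + t * c l)) * u j) g' 0 ∧ |g'| ≤ enorm u * enorm c := by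
  set Z := ∑ l, Real.exp (a l) with hZ
  have hZpos : 0 < Z := Finset.sum_pos (fun _ _ => Real.exp_pos _) Finset.univ_nonempty
  have hE : ∀ j, HasDerivAt (fun t : ℝ => Real.exp (a j + t * c j)) (Real.exp (a j) * c j) 0 := by
    intro j
    have := (((hasDerivAt_id (0:ℝ)).mul_const (c j)).const_add (a j)).exp
    simpa using this
  have hS : HasDerivAt (fun t : ℝ => ∑ l, Real.exp (a l + t * c l))
      (∑ l, Real.exp (a l) * c l) 0 := HasDerivAt.fun_sum fun l _ => hE l
  have hS0 : (∑ l, Real.exp (a l + 0 * c l)) = Z := by simp [hZ]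
  have hall := HasDerivAt.fun_sum (u := Finset.univ) fun j _ =>
    ((hE j).fun_div hS (by rw [hS0]; exact hZpos.ne')).mul_const (u j)
  refine ⟨_, hall, ?_⟩
  have hc := cov_bound (fun j => Real.exp (a j) / Z) u c
    (fun j => div_nonneg (Real.exp_pos _).le hZpos.le)
    (by rw [← Finset.sum_div, ← hZ, div_self hZpos.ne'])
  refine le_trans (le_of_eq ?_) hc
  congr 1
  simp only [hS0]
  simp only [zero_mul, add_zero]
  rw [Finset.sum_mul, ← Finset.sum_sub_distrib]
  apply Finset.sum_congr rfl
  intro j _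
  have : ∑ l, Real.exp (a l) / Z * c l = (∑ l, Real.exp (a l) * c l) / Z := by
    rw [Finset.sum_div]
    exact Finset.sum_congr rfl fun l _ => by ring
  rw [this]
  field_simp

lemma attnC_row_bound (W WK : Matrix (Fin D) (Fin d) ℝ) (Xi : Matrix (Fin n) (Fin D) ℝ)
    (k : Fin n) :
    enorm (attnC W WK Xi k) ≤ frob Xi * (sigmaMax WK * (frob W * enorm (Xi k))) := by
  have e : attnC W WK Xi k =
      (Real.sqrt (d : ℝ))⁻¹ • Xi.mulVec (WK.mulVec (Wᵀ.mulVec (Xi k))) := by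
    unfold attnC
    funext j
    rw [Matrix.mulVec_mulVec, Matrix.mulVec_transpose]
    simp only [Matrix.smul_apply, Pi.smul_apply]
    congr 1
    rw [Matrix.mul_apply]
    simp only [Matrix.mulVec, dotProduct, Matrix.transpose_apply]
    apply Finset.sum_congr rfl
    intro l _
    rw [mul_comm]
    rfl
  have hs : (Real.sqrt (d : ℝ))⁻¹ ≤ 1 := by
    rcases Nat.eq_zero_or_pos d with h | h
    · simp [h]
    · apply inv_le_one_of_one_le₀
      rw [Real.one_le_sqrt]
      exact_mod_cast h
  have ht : frob Wᵀ = frob W := by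
    unfold frob
    rw [Finset.sum_comm]
    rfl
  rw [e, enorm_smul' _ (by positivity)]
  refine (mul_le_of_le_one_left (enorm_nonneg' _) hs).trans ?_
  refine (enorm_mulVec_le_frob _ _).trans (mul_le_mul_of_nonneg_left ?_ (frob_nonneg' _))
  refine (enorm_mulVec_le_sigmaMax _ _).trans (mul_le_mul_of_nonneg_left ?_ (sigmaMax_nonneg' _))
  rw [← ht]
  exact enorm_mulVec_le_frob _ _

lemma attnC_line (v w : EuclideanSpace ℝ (Fin H × Fin D × Fin d)) (WK : Matrix (Fin D) (Fin d) ℝ)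
    (Xi : Matrix (Fin n) (Fin D) ℝ) (h : Fin H) (t : ℝ) (k j : Fin n) :
    attnC (headMat (v + t • w) h) WK Xi k j =
      attnC (headMat v h) WK Xi k j + t * attnC (headMat w h) WK Xi k j := by
  have e : headMat (v + t • w) h = headMat v h + t • headMat w h := by
    ext p q; simp [headMat]
  rw [e]
  unfold attnC
  simp only [Matrix.mul_add, Matrix.add_mul, Matrix.mul_smul, Matrix.smul_mul, Matrix.smul_apply,
    Matrix.add_apply, smul_eq_mul]
  ring

lemma MH_eq (S : Fin H → Matrix (Fin n) (Fin n) ℝ) (WV : Fin H → Matrix (Fin D) (Fin d) ℝ)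
    (WO : Fin H → Fin d → ℝ) (Xi : Matrix (Fin n) (Fin D) ℝ) (k : Fin n) :
    MH S WV WO Xi k = ∑ h, ∑ j, S h k j * Xi.mulVec ((WV h).mulVec (WO h)) j := by
  unfold MH
  apply Finset.sum_congr rfl
  intro h _
  change ((S h * Xi * WV h).mulVec (WO h)) k = (S h).mulVec _ k
  simp only [Matrix.mulVec_mulVec, Matrix.mul_assoc]

lemma sum_headMat (w : EuclideanSpace ℝ (Fin H × Fin D × Fin d)) :
    enorm (fun h => frob (headMat w h)) = ‖w‖ := by
  rw [EuclideanSpace.norm_eq]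
  unfold enorm
  simp only [frob_sq', Fintype.sum_prod_type, headMat, Real.norm_eq_abs, sq_abs, Matrix.of_apply]

lemma MH_line (Xi : Matrix (Fin n) (Fin D) ℝ)
    (WK WV : Fin H → Matrix (Fin D) (Fin d) ℝ) (WO : Fin H → Fin d → ℝ)
    (v w : EuclideanSpace ℝ (Fin H × Fin D × Fin d)) (k : Fin n) :
    ∃ g' : ℝ, HasDerivAt (fun t : ℝ =>
        MH (fun h => Ssoft (headMat (v + t • w) h) (WK h) Xi) WV WO Xi k) g' 0 ∧
      |g'| ≤ (frob Xi ^ 2 * (sigmaMax (diagWV WV) * WOnorm WO) *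
        (Real.sqrt (∑ h, sigmaMax (WK h) ^ 2) * ‖w‖)) * enorm (Xi k) := by
  haveI : Nonempty (Fin n) := ⟨k⟩
  choose g hg hgb using fun h : Fin H => softmax_line (attnC (headMat v h) (WK h) Xi k)
    (attnC (headMat w h) (WK h) Xi k) (Xi.mulVec ((WV h).mulVec (WO h)))
  refine ⟨∑ h, g h, ?_, ?_⟩
  · have := HasDerivAt.fun_sum (u := Finset.univ) fun h _ => hg h
    refine this.congr_deriv rfl |>.congr_of_eventuallyEq (Filter.Eventually.of_forall fun t => ?_)
    simp only [MH_eq, Ssoft, softmaxMat, Matrix.of_apply, attnC_line]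
  · have hX := frob_nonneg' Xi
    have hb : ∀ h, |g h| ≤ (frob Xi ^ 2 * (sigmaMax (diagWV WV) * WOnorm WO) * enorm (Xi k)) *
        (sigmaMax (WK h) * frob (headMat w h)) := by
      intro h
      have h1 : enorm (Xi.mulVec ((WV h).mulVec (WO h))) ≤
          frob Xi * (sigmaMax (diagWV WV) * WOnorm WO) :=
        (enorm_mulVec_le_frob _ _).trans (mul_le_mul_of_nonneg_left (enorm_WV_WO WV WO h) hX)
      have h2 := attnC_row_bound (headMat w h) (WK h) Xi k
      refine (hgb h).trans ((mul_le_mul h1 h2 (enorm_nonneg' _)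
        ((enorm_nonneg' _).trans h1)).trans (le_of_eq (by ring)))
    refine (Finset.abs_sum_le_sum_abs _ _).trans ((Finset.sum_le_sum fun h _ => hb h).trans ?_)
    rw [← Finset.mul_sum]
    have hcs : ∑ h, sigmaMax (WK h) * frob (headMat w h) ≤
        Real.sqrt (∑ h, sigmaMax (WK h) ^ 2) * ‖w‖ := by
      rw [← sum_headMat]
      exact (le_abs_self _).trans (abs_sum_le_enorm (fun h => sigmaMax (WK h)) _)
    have hn : 0 ≤ frob Xi ^ 2 * (sigmaMax (diagWV WV) * WOnorm WO) * enorm (Xi k) :=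
      mul_nonneg (mul_nonneg (sq_nonneg _) (mul_nonneg (sigmaMax_nonneg' _) (enorm_nonneg' _)))
        (enorm_nonneg' _)
    exact (mul_le_mul_of_nonneg_left hcs hn).trans (le_of_eq (by ring))

/-- Lemma 2(4) of the paper. Per-sample query-gradient bound for the
Softmax-attention Transformer:
`‖∇_{W^Q} f(M;X_i)‖_F ≤ Q_i ‖MH(M;X_i) − y_i‖₂` with
`Q_i = n √H ‖X_i‖_F³ ‖W^O‖₂ √(Σ_h σ_max²(W^K_h)) σ_max(W^V)`. -/
theorem softmax_per_sample_query_gradient_bound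
    {n D d H : ℕ}
    (Xi : Matrix (Fin n) (Fin D) ℝ) (yi : Fin n → ℝ)
    (WK WV : Fin H → Matrix (Fin D) (Fin d) ℝ) (WO : Fin H → Fin d → ℝ)
    (f : EuclideanSpace ℝ (Fin H × Fin D × Fin d) → ℝ)
    (hf : f = fun v =>
      (1 / 2) * ∑ k, (MH (fun h => Ssoft (headMat v h) (WK h) Xi) WV WO Xi k - yi k) ^ 2) :
    ∀ v : EuclideanSpace ℝ (Fin H × Fin D × Fin d),
      ‖gradient f v‖ ≤
        (n * Real.sqrt (H : ℝ) * frob Xi ^ 3 * WOnorm WO *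
            Real.sqrt (∑ h, sigmaMax (WK h) ^ 2) * sigmaMax (diagWV WV)) *
          enorm (fun k => MH (fun h => Ssoft (headMat v h) (WK h) Xi) WV WO Xi k - yi k) := by
  intro v
  set r : Fin n → ℝ :=
    fun k => MH (fun h => Ssoft (headMat v h) (WK h) Xi) WV WO Xi k - yi k with hr
  have hX := frob_nonneg' Xi
  have hO : 0 ≤ WOnorm WO := enorm_nonneg' _
  have hV := sigmaMax_nonneg' (diagWV WV)
  have hR := enorm_nonneg' r
  set s := Real.sqrt (∑ h, sigmaMax (WK h) ^ 2) with hs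
  have hs0 : 0 ≤ s := Real.sqrt_nonneg _
  have hbase : 0 ≤ frob Xi ^ 3 * WOnorm WO * s * sigmaMax (diagWV WV) * enorm r := by positivity
  have hQ : frob Xi ^ 3 * WOnorm WO * s * sigmaMax (diagWV WV) * enorm r ≤
      (n * Real.sqrt (H : ℝ) * frob Xi ^ 3 * WOnorm WO * s * sigmaMax (diagWV WV)) * enorm r := by
    rcases Nat.eq_zero_or_pos n with hn | hn
    · subst hn
      have : frob Xi = 0 := by simp [frob]
      simp [this]
    rcases Nat.eq_zero_or_pos H with hH | hH
    · subst hH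
      have : s = 0 := by simp [hs]
      simp [this]
    have h1 : (1:ℝ) ≤ n := by exact_mod_cast hn
    have h2 : (1:ℝ) ≤ Real.sqrt (H : ℝ) := by
      rw [Real.one_le_sqrt]; exact_mod_cast hH
    have h3 : (1:ℝ) ≤ n * Real.sqrt (H : ℝ) := one_le_mul_of_one_le_of_one_le h1 h2
    refine (le_mul_of_one_le_left hbase h3).trans (le_of_eq (by ring))
  refine le_trans ?_ hQ
  have hgrad : ‖gradient f v‖ = ‖fderiv ℝ f v‖ := by
    unfold gradient
    exact LinearIsometryEquiv.norm_map _ _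
  rw [hgrad]
  by_cases hd : DifferentiableAt ℝ f v
  swap
  · rw [fderiv_zero_of_not_differentiableAt hd, norm_zero]
    exact hbase
  apply ContinuousLinearMap.opNorm_le_bound _ hbase
  intro w
  have hline : HasDerivAt (fun t : ℝ => f (v + t • w)) (fderiv ℝ f v w) 0 :=
    hd.hasFDerivAt.hasLineDerivAt w
  choose g hg hgb using MH_line Xi WK WV WO v w
  have hcalc : HasDerivAt (fun t : ℝ => f (v + t • w)) (∑ k, r k * g k) 0 := by
    rw [hf]
    have h1 := (HasDerivAt.fun_sum (u := Finset.univ) fun k _ =>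
      ((hg k).sub_const (yi k)).fun_pow 2).const_mul (1 / 2 : ℝ)
    refine h1.congr_deriv ?_
    rw [Finset.mul_sum]
    apply Finset.sum_congr rfl
    intro k _
    simp only [zero_smul, add_zero, hr]
    push_cast
    ring
  rw [hline.unique hcalc, Real.norm_eq_abs]
  set K := frob Xi ^ 2 * (sigmaMax (diagWV WV) * WOnorm WO) * (s * ‖w‖) with hK
  have hK0 : 0 ≤ K := by positivity
  have hgn : enorm g ≤ K * frob Xi := by
    apply enorm_le_of_sq _ _ (mul_nonneg hK0 hX)
    rw [mul_pow, frob_sq', Finset.mul_sum]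
    apply Finset.sum_le_sum
    intro k _
    rw [← enorm_sq' (Xi k), ← mul_pow, ← sq_abs (g k)]
    exact pow_le_pow_left₀ (abs_nonneg _) (hgb k) 2
  refine (abs_sum_le_enorm r g).trans ((mul_le_mul_of_nonneg_left hgn hR).trans (le_of_eq ?_))
  rw [hK]
  ring

end Paper
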